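/- Let p ≥ 1, q ≥ 0 and 0 ≤ i ≤ p−1. Let H ⊆ E be such that for every A with ∅ ≠ A ⊊ V, if |δ_H(A)| = p+q then |δ_{H∩𝒮}(A)| ≥ i. Define 𝒞_i = {A ⊆ V : ∅ ≠ A ⊊ V, |δ_H(A)| = p+q and |δ_{H∩𝒮}(A)| = i}. Let A, B ∈ 𝒞_i properly intersect. Then: (1) if |δ_H(A ∩ B)| = |δ_H(A ∪ B)| = p+q, then A ∩ B ∈ 𝒞_i and A ∪ B ∈ 𝒞_i; and (2) if |δ_H(A \ B)| = |δ_H(B \ A)| = p+q, then A \ B ∈ 𝒞_i and B \ A ∈ 𝒞_i. In either case A and B uncross. -/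

import Mathlib

open scoped BigOperators

/-- An edge `e` crosses the vertex set `A` if exactly one of its endpoints lies in `A`. -/
def crosses {V E : Type*} (ends : E → Sym2 V) (A : Set V) (e : E) : Prop :=
  ∃ u v : V, ends e = s(u, v) ∧ u ∈ A ∧ v ∉ A

/-- `cut ends F A` is `δ_F(A)`: the set of edges of `F` with exactly one endpoint in `A`. -/
def cut {V E : Type*} (ends : E → Sym2 V) (F : Set E) (A : Set V) : Set E :=
  {e | e ∈ F ∧ crosses ends A e}

/-- Two vertex sets properly intersect. -/
def properlyIntersect {V : Type*} (A B : Set V) : Prop :=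
  (A ∩ B).Nonempty ∧ (A \ B).Nonempty ∧ (B \ A).Nonempty

/-- `F` is feasible for `(p,q)`-FGC. -/
def fgcFeasible {V E : Type*} (ends : E → Sym2 V) (𝒮 : Set E) (p q : ℕ) (F : Set E) : Prop :=
  ∀ A : Set V, A.Nonempty → A ≠ Set.univ →
    p ≤ (cut ends (F ∩ 𝒮) A).ncard ∨ p + q ≤ (cut ends F A).ncard

/-- Two properly intersecting members of the family `𝒞` uncross. -/
def uncross {V : Type*} (𝒞 : Set (Set V)) (A B : Set V) : Prop :=
  (A ∩ B ∈ 𝒞 ∧ A ∪ B ∈ 𝒞) ∨ (A \ B ∈ 𝒞 ∧ B \ A ∈ 𝒞)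

/-- The family `𝒞` is uncrossable. -/
def uncrossable {V : Type*} (𝒞 : Set (Set V)) : Prop :=
  ∀ A B, A ∈ 𝒞 → B ∈ 𝒞 → properlyIntersect A B → uncross 𝒞 A B

theorem crosses_iff_of_ends_eq {V E : Type*} {ends : E → Sym2 V} {e : E} {u v : V}
    (h : ends e = s(u, v)) (A : Set V) : crosses ends A e ↔ ¬(u ∈ A ↔ v ∈ A) := by
  constructor
  · rintro ⟨x, y, hxy, hx, hy⟩
    rw [h, Sym2.eq_iff] at hxy
    rcases hxy with ⟨rfl, rfl⟩ | ⟨rfl, rfl⟩ <;> tauto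
  · intro huv
    by_cases hu : u ∈ A
    · exact ⟨u, v, h, hu, by tauto⟩
    · exact ⟨v, u, h.trans Sym2.eq_swap, by tauto, hu⟩

theorem cut_compl {V E : Type*} (ends : E → Sym2 V) (F : Set E) (A : Set V) :
    cut ends F Aᶜ = cut ends F A := by
  ext e
  obtain ⟨u, v, h⟩ : ∃ u v, ends e = s(u, v) := (ends e).ind fun u v => ⟨u, v, rfl⟩
  simp only [cut, Set.mem_ofPred_eq, crosses_iff_of_ends_eq h, Set.mem_compl_iff, not_iff_not]

theorem cut_univ {V E : Type*} (ends : E → Sym2 V) (F : Set E) :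
    cut ends F Set.univ = ∅ := by
  simp [cut, crosses]

/-- The cut function is submodular. -/
theorem ncard_cut_inter_add_ncard_cut_union_le {V E : Type*} [Finite E] (ends : E → Sym2 V)
    (F : Set E) (A B : Set V) :
    (cut ends F (A ∩ B)).ncard + (cut ends F (A ∪ B)).ncard ≤
      (cut ends F A).ncard + (cut ends F B).ncard := by
  rw [← Set.ncard_union_add_ncard_inter (cut ends F (A ∩ B)),
    ← Set.ncard_union_add_ncard_inter (cut ends F A)]
  refine add_le_add (Set.ncard_le_ncard fun e => ?_) (Set.ncard_le_ncard fun e => ?_) <;>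
  · obtain ⟨u, v, h⟩ : ∃ u v, ends e = s(u, v) := (ends e).ind fun u v => ⟨u, v, rfl⟩
    simp only [cut, Set.mem_union, Set.mem_inter_iff, Set.mem_ofPred_eq, crosses_iff_of_ends_eq h]
    tauto

/-- The cut function is posimodular. -/
theorem ncard_cut_sdiff_add_ncard_cut_sdiff_le {V E : Type*} [Finite E] (ends : E → Sym2 V)
    (F : Set E) (A B : Set V) :
    (cut ends F (A \ B)).ncard + (cut ends F (B \ A)).ncard ≤
      (cut ends F A).ncard + (cut ends F B).ncard := by
  have h := ncard_cut_inter_add_ncard_cut_union_le ends F A Bᶜ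
  have hunion : A ∪ Bᶜ = (B \ A)ᶜ := by
    rw [Set.sdiff_eq, Set.compl_inter, compl_compl, Set.union_comm]
  rwa [hunion, cut_compl, cut_compl, ← Set.sdiff_eq] at h

theorem stmt8 {V E : Type*} [Fintype V] [Fintype E]
    (ends : E → Sym2 V) (𝒮 𝒰 : Set E)
    (hpart : 𝒮 ∪ 𝒰 = Set.univ) (hdisj : Disjoint 𝒮 𝒰)
    (p q i : ℕ) (hp : 1 ≤ p) (hi : i ≤ p - 1)
    (H : Set E)
    (hH : ∀ A : Set V, A.Nonempty → A ≠ Set.univ →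
      (cut ends H A).ncard = p + q → i ≤ (cut ends (H ∩ 𝒮) A).ncard)
    (Ci : Set (Set V))
    (hCi : Ci = {A : Set V | A.Nonempty ∧ A ≠ Set.univ ∧
      (cut ends H A).ncard = p + q ∧ (cut ends (H ∩ 𝒮) A).ncard = i})
    (A B : Set V) (hA : A ∈ Ci) (hB : B ∈ Ci) (hAB : properlyIntersect A B) :
    ((cut ends H (A ∩ B)).ncard = p + q → (cut ends H (A ∪ B)).ncard = p + q →
      A ∩ B ∈ Ci ∧ A ∪ B ∈ Ci) ∧
    ((cut ends H (A \ B)).ncard = p + q → (cut ends H (B \ A)).ncard = p + q →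
      A \ B ∈ Ci ∧ B \ A ∈ Ci) ∧
    (((cut ends H (A ∩ B)).ncard = p + q ∧ (cut ends H (A ∪ B)).ncard = p + q) ∨
      ((cut ends H (A \ B)).ncard = p + q ∧ (cut ends H (B \ A)).ncard = p + q) →
      uncross Ci A B) := by
  subst hCi
  obtain ⟨-, -, -, hAi⟩ := hA
  obtain ⟨-, -, -, hBi⟩ := hB
  obtain ⟨hinter, hAsdiff, hBsdiff⟩ := hAB
  have ne_univ_of_ncard {X : Set V} (hX : (cut ends H X).ncard = p + q) : X ≠ Set.univ := by
    rintro rfl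
    rw [cut_univ, Set.ncard_empty] at hX
    omega
  have mem_of_ncard_add_le {X Y : Set V} (hX : X.Nonempty) (hY : Y.Nonempty)
      (hXH : (cut ends H X).ncard = p + q) (hYH : (cut ends H Y).ncard = p + q)
      (hle : (cut ends (H ∩ 𝒮) X).ncard + (cut ends (H ∩ 𝒮) Y).ncard ≤
        (cut ends (H ∩ 𝒮) A).ncard + (cut ends (H ∩ 𝒮) B).ncard) :
      X ∈ {A : Set V | A.Nonempty ∧ A ≠ Set.univ ∧
        (cut ends H A).ncard = p + q ∧ (cut ends (H ∩ 𝒮) A).ncard = i} ∧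
      Y ∈ {A : Set V | A.Nonempty ∧ A ≠ Set.univ ∧
        (cut ends H A).ncard = p + q ∧ (cut ends (H ∩ 𝒮) A).ncard = i} := by
    have hXi := hH X hX (ne_univ_of_ncard hXH) hXH
    have hYi := hH Y hY (ne_univ_of_ncard hYH) hYH
    exact ⟨⟨hX, ne_univ_of_ncard hXH, hXH, by omega⟩, ⟨hY, ne_univ_of_ncard hYH, hYH, by omega⟩⟩
  have hcap_cup := fun h₁ h₂ => mem_of_ncard_add_le hinter
    (hinter.mono (Set.inter_subset_left.trans Set.subset_union_left)) h₁ h₂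
    (ncard_cut_inter_add_ncard_cut_union_le ends (H ∩ 𝒮) A B)
  have hsdiff := fun h₁ h₂ => mem_of_ncard_add_le hAsdiff hBsdiff h₁ h₂
    (ncard_cut_sdiff_add_ncard_cut_sdiff_le ends (H ∩ 𝒮) A B)
  exact ⟨hcap_cup, hsdiff, Or.imp (fun h => hcap_cup h.1 h.2) (fun h => hsdiff h.1 h.2)⟩
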